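/- arXiv:1312.0308 — 2 statements merged into one kernel-verified Lean document; each statement's English description precedes it below -/
import Mathlib

section
/- Let L ≥ 0, let m ≥ 1, and let f_1, …, f_m : ℝ → ℝ each be Lipschitz with constant L. For 1 ≤ k ≤ m, the function t ↦ kmax(f_1(t), …, f_m(t)), the k-th largest value among f_1(t), …, f_m(t), is Lipschitz with constant L. In particular, for a finite persistence diagram D = {(b_i, d_i)}_{i∈I} the k-th persistence landscape function λ_D(k, ·) = kmax_{i∈I} Λ_{(b_i,d_i)}(·) is 1-Lipschitz. -/
noncomputable section

/-- The tent (triangle) function `Λ_{(b,d)}(t) = max (0, min (t - b, d - t))`. -/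
def tent (b d t : ℝ) : ℝ := max 0 (min (t - b) (d - t))

/-- `kmax k l` is the `k`-th largest value in the list `l` (counted with multiplicity),
defined to be `0` if `l` has fewer than `k` elements. -/
def kmax (k : ℕ) (l : List ℝ) : ℝ := (l.insertionSort (· ≥ ·)).getD (k - 1) 0

theorem orderedInsert_eq_cons_of_pairwise {a : ℝ} {l : List ℝ}
    (h : (a :: l).Pairwise (· ≥ ·)) : l.orderedInsert (· ≥ ·) a = a :: l := by
  cases l with
  | nil => rfl
  | cons x xs =>
    exact List.orderedInsert_cons_of_le _ xs (List.rel_of_pairwise_cons h List.mem_cons_self)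

/-- Inserting into decreasing lists preserves pointwise domination up to an additive constant. -/
theorem forall₂_orderedInsert_le_add {c a b : ℝ} (hab : a ≤ b + c) {l l' : List ℝ}
    (h : List.Forall₂ (fun x y => x ≤ y + c) l l') (hl : l.Pairwise (· ≥ ·))
    (hl' : l'.Pairwise (· ≥ ·)) :
    List.Forall₂ (fun x y => x ≤ y + c)
      (l.orderedInsert (· ≥ ·) a) (l'.orderedInsert (· ≥ ·) b) := by
  induction h generalizing a b with
  | nil => simpa using hab
  | @cons x y xs ys hxy hs ih =>
    have hx : xs.orderedInsert (· ≥ ·) x = x :: xs :=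
      orderedInsert_eq_cons_of_pairwise hl
    have hy : ys.orderedInsert (· ≥ ·) y = y :: ys :=
      orderedInsert_eq_cons_of_pairwise hl'
    have ih' : ∀ {p q : ℝ}, p ≤ q + c → List.Forall₂ (fun x y => x ≤ y + c)
        (xs.orderedInsert (· ≥ ·) p) (ys.orderedInsert (· ≥ ·) q) :=
      fun hpq => ih hpq hl.of_cons hl'.of_cons
    simp only [List.orderedInsert_cons]
    split_ifs with h₁ h₂ h₂
    · exact .cons hab (.cons hxy hs)
    · refine .cons (by linarith) ?_
      rw [← hx]
      exact ih' (by linarith)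
    · refine .cons (by linarith) ?_
      rw [← hy]
      exact ih' (by linarith)
    · exact .cons hxy (ih' hab)

/-- Sorting in decreasing order preserves pointwise domination up to an additive constant. -/
theorem forall₂_insertionSort_le_add {c : ℝ} {l l' : List ℝ}
    (h : List.Forall₂ (fun x y => x ≤ y + c) l l') :
    List.Forall₂ (fun x y => x ≤ y + c)
      (l.insertionSort (· ≥ ·)) (l'.insertionSort (· ≥ ·)) := by
  induction h with
  | nil => exact .nil
  | cons hxy _ ih =>
    exact forall₂_orderedInsert_le_add hxy ih (List.pairwise_insertionSort _ _)
      (List.pairwise_insertionSort _ _)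

theorem kmax_le_kmax_add {c : ℝ} (hc : 0 ≤ c) (k : ℕ) {l l' : List ℝ}
    (h : List.Forall₂ (fun x y => x ≤ y + c) l l') : kmax k l ≤ kmax k l' + c := by
  have hs := forall₂_insertionSort_le_add h
  unfold kmax
  generalize k - 1 = n
  generalize l.insertionSort (· ≥ ·) = u at hs ⊢
  generalize l'.insertionSort (· ≥ ·) = v at hs ⊢
  induction hs generalizing n with
  | nil => simpa using hc
  | cons hxy _ ih =>
    cases n with
    | zero => simpa using hxy
    | succ n => simpa using ih n

theorem lipschitzWith_kmax_ofFn {L : NNReal} {m : ℕ} {f : Fin m → ℝ → ℝ}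
    (hf : ∀ i, LipschitzWith L (f i)) (k : ℕ) :
    LipschitzWith L (fun t => kmax k (List.ofFn fun i => f i t)) := by
  refine LipschitzWith.of_le_add_mul L fun s t => kmax_le_kmax_add (by positivity) k ?_
  rw [List.forall₂_iff_get]
  refine ⟨by simp, fun i _ _ => ?_⟩
  simpa using (hf _).le_add_mul s t

theorem lipschitzWith_tent (b d : ℝ) : LipschitzWith 1 (tent b d) := by
  refine LipschitzWith.of_le_add fun s t => ?_
  have h := abs_le.mp (Real.dist_eq s t).ge
  unfold tent
  grind

/-- If `f_1, …, f_m : ℝ → ℝ` are each Lipschitz with constant `L`, then for `1 ≤ k ≤ m`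
the function `t ↦ kmax (f_1 t, …, f_m t)` is Lipschitz with constant `L`.  In particular,
for a finite persistence diagram `D = {(b_i, d_i)}` the `k`-th landscape function
`λ_D(k, ·) = kmax_i Λ_{(b_i,d_i)}(·)` is 1-Lipschitz. -/
theorem kmax_lipschitz (L : NNReal) (m : ℕ) (hm : 1 ≤ m)
    (f : Fin m → ℝ → ℝ) (hf : ∀ i, LipschitzWith L (f i))
    (k : ℕ) (hk1 : 1 ≤ k) (hkm : k ≤ m) :
    LipschitzWith L (fun t => kmax k (List.ofFn fun i => f i t)) ∧
    ∀ (ι : ℕ) (b d : Fin ι → ℝ), (∀ i, b i ≤ d i) →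
      LipschitzWith 1 (fun t => kmax k (List.ofFn fun i => tent (b i) (d i) t)) := by
  exact ⟨lipschitzWith_kmax_ofFn hf k, fun _ b d _ =>
    lipschitzWith_kmax_ofFn (fun i => lipschitzWith_tent (b i) (d i)) k⟩
end
end

section
/- Under the stated assumptions, for every landscape-type function λ and all t, u ∈ [t₁, t₂] one has |λ(t)/σ(t) − λ(u)/σ(u)| ≤ |t − u| (T² + 2c²)/(2c³); that is, each standardized evaluation function g_t(λ) = λ(t)/σ(t) varies Lipschitz-continuously in t with constant (T² + 2c²)/(2c³), uniformly over landscape-type functions. -/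
open MeasureTheory Set

noncomputable section

/-- A landscape-type function for `T`: 1-Lipschitz, with values in `[0, T/2]`,
and vanishing outside `[0, T]`. -/
def IsLandscapeType (T : ℝ) (f : ℝ → ℝ) : Prop :=
  LipschitzWith 1 f ∧ (∀ t, 0 ≤ f t ∧ f t ≤ T / 2) ∧ ∀ t ∉ Set.Icc (0 : ℝ) T, f t = 0

/-- The Borel σ-algebra on the space `C(ℝ, ℝ)` of continuous functions with the
topology of uniform convergence on compact sets (the compact-open topology). -/
instance : MeasurableSpace C(ℝ, ℝ) := borel _

instance : BorelSpace C(ℝ, ℝ) := ⟨rfl⟩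

/-- The mean function `μ(t) = ∫ λ(t) dP(λ)`. -/
def lmean (P : Measure C(ℝ, ℝ)) (t : ℝ) : ℝ := ∫ f, f t ∂P

/-- The variance function `σ(t)² = ∫ λ(t)² dP(λ) − μ(t)²`. -/
def lvar (P : Measure C(ℝ, ℝ)) (t : ℝ) : ℝ := (∫ f, (f t) ^ 2 ∂P) - (lmean P t) ^ 2

/-- The standard deviation function `σ(t)`. -/
def lsd (P : Measure C(ℝ, ℝ)) (t : ℝ) : ℝ := Real.sqrt (lvar P t)

lemma isClosed_setOf_isLandscapeType (T : ℝ) :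
    IsClosed {f : C(ℝ, ℝ) | IsLandscapeType T f} := by
  have hev (t : ℝ) : Continuous fun f : C(ℝ, ℝ) => f t := continuous_eval_const t
  simp only [IsLandscapeType, lipschitzWith_iff_dist_le_mul, ofPred_and, ofPred_forall]
  refine .inter ?_ (.inter ?_ ?_)
  · exact isClosed_iInter fun x => isClosed_iInter fun y =>
      isClosed_le ((hev x).dist (hev y)) continuous_const
  · exact isClosed_iInter fun t =>
      (isClosed_le continuous_const (hev t)).inter (isClosed_le (hev t) continuous_const)
  · exact isClosed_iInter fun t => isClosed_iInter fun _ =>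
      isClosed_eq (hev t) continuous_const

lemma ae_isLandscapeType {T : ℝ} {P : Measure C(ℝ, ℝ)} [IsProbabilityMeasure P]
    (hP : P {f | IsLandscapeType T f} = 1) : ∀ᵐ f : C(ℝ, ℝ) ∂P, IsLandscapeType T f :=
  (mem_ae_iff_prob_eq_one (isClosed_setOf_isLandscapeType T).measurableSet).2 hP

lemma IsLandscapeType.abs_sub_le {T : ℝ} {f : ℝ → ℝ} (hf : IsLandscapeType T f) (t u : ℝ) :
    |f t - f u| ≤ |t - u| := by
  simpa [Real.dist_eq] using hf.1.dist_le_mul t u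

lemma abs_sq_sub_sq_le {x y T d : ℝ} (hx : 0 ≤ x ∧ x ≤ T / 2) (hy : 0 ≤ y ∧ y ≤ T / 2)
    (hxy : |x - y| ≤ d) : |x ^ 2 - y ^ 2| ≤ T * d := by
  rw [sq_sub_sq, abs_mul, abs_of_nonneg (add_nonneg hx.1 hy.1)]
  exact mul_le_mul (by linarith) hxy (abs_nonneg _) (by linarith)

section Moments

variable {T : ℝ} {P : Measure C(ℝ, ℝ)} [IsProbabilityMeasure P]

lemma integrable_eval_pow (h : ∀ᵐ f : C(ℝ, ℝ) ∂P, IsLandscapeType T f) (n : ℕ) (t : ℝ) :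
    Integrable (fun f : C(ℝ, ℝ) => f t ^ n) P := by
  refine .of_bound (C := (T / 2) ^ n)
    ((continuous_eval_const t).pow n).measurable.aestronglyMeasurable ?_
  filter_upwards [h] with f hf
  rw [Real.norm_of_nonneg (pow_nonneg (hf.2.1 t).1 n)]
  exact pow_le_pow_left₀ (hf.2.1 t).1 (hf.2.1 t).2 n

lemma abs_integral_sub_integral_le {g h : C(ℝ, ℝ) → ℝ} {C : ℝ} (hg : Integrable g P)
    (hh : Integrable h P) (hgh : ∀ᵐ f ∂P, |g f - h f| ≤ C) :
    |∫ f, g f ∂P - ∫ f, h f ∂P| ≤ C := by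
  rw [← integral_sub hg hh]
  simpa using norm_integral_le_of_norm_le_const (f := fun f => g f - h f) hgh

lemma lmean_mem (h : ∀ᵐ f : C(ℝ, ℝ) ∂P, IsLandscapeType T f) (t : ℝ) :
    0 ≤ lmean P t ∧ lmean P t ≤ T / 2 := by
  constructor
  · exact integral_nonneg_of_ae (h.mono fun f hf => (hf.2.1 t).1)
  · have hi : Integrable (fun f : C(ℝ, ℝ) => f t) P := by simpa using integrable_eval_pow h 1 t
    simpa [lmean] using
      integral_mono_ae hi (integrable_const (T / 2)) (h.mono fun f hf => (hf.2.1 t).2)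

lemma abs_lmean_sub_le (h : ∀ᵐ f : C(ℝ, ℝ) ∂P, IsLandscapeType T f) (t u : ℝ) :
    |lmean P t - lmean P u| ≤ |t - u| :=
  abs_integral_sub_integral_le (by simpa using integrable_eval_pow h 1 t)
    (by simpa using integrable_eval_pow h 1 u) (h.mono fun _ hf => hf.abs_sub_le t u)

lemma abs_lvar_sub_le (h : ∀ᵐ f : C(ℝ, ℝ) ∂P, IsLandscapeType T f) (t u : ℝ) :
    |lvar P t - lvar P u| ≤ 2 * T * |t - u| := by
  have h₁ := abs_integral_sub_integral_le (integrable_eval_pow h 2 t) (integrable_eval_pow h 2 u)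
    (h.mono fun f hf => abs_sq_sub_sq_le (hf.2.1 t) (hf.2.1 u) (hf.abs_sub_le t u))
  have h₂ := abs_sq_sub_sq_le (lmean_mem h t) (lmean_mem h u) (abs_lmean_sub_le h t u)
  rw [abs_le] at *
  unfold lvar
  constructor <;> linarith

/-- The standard deviation is Lipschitz with constant `T / c` where it is at least `c`. -/
lemma abs_lsd_sub_le (h : ∀ᵐ f : C(ℝ, ℝ) ∂P, IsLandscapeType T f) {c t u : ℝ} (hc : 0 < c)
    (ht : c ≤ lsd P t) (hu : c ≤ lsd P u) : |lsd P t - lsd P u| ≤ T * |t - u| / c := by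
  have hsq {s : ℝ} (hs : c ≤ lsd P s) : lsd P s ^ 2 = lvar P s :=
    Real.sq_sqrt (Real.sqrt_pos.1 (hc.trans_le hs)).le
  have hv := abs_lvar_sub_le h t u
  rw [← hsq ht, ← hsq hu, sq_sub_sq, abs_mul, abs_of_nonneg (by linarith)] at hv
  rw [le_div_iff₀ hc]
  nlinarith [mul_le_mul_of_nonneg_right (add_le_add ht hu) (abs_nonneg (lsd P t - lsd P u))]

end Moments

lemma abs_div_sub_div_le {a b x y c : ℝ} (hc : 0 < c) (hx : c ≤ x) (hy : c ≤ y) :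
    |a / x - b / y| ≤ |a - b| / c + |b| * |x - y| / c ^ 2 := by
  have hx0 : 0 < x := hc.trans_le hx
  have hy0 : 0 < y := hc.trans_le hy
  have key : a / x - b / y = (a - b) / x - b * (x - y) / (x * y) := by
    field_simp
    ring
  rw [key]
  refine (abs_sub _ _).trans (add_le_add ?_ ?_)
  · rw [abs_div, abs_of_pos hx0]
    gcongr
  · rw [abs_div, abs_mul, abs_of_pos (mul_pos hx0 hy0), sq]
    gcongr

/-- If `σ(t) ≥ c > 0` on `[t₁, t₂] ⊆ [0, T]`, then for every landscape-type function `λ`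
and all `t, u ∈ [t₁, t₂]`,
`|λ(t)/σ(t) − λ(u)/σ(u)| ≤ |t − u| (T² + 2c²)/(2c³)`: the standardized evaluation
functions `g_t(λ) = λ(t)/σ(t)` vary Lipschitz-continuously in `t`, uniformly over
landscape-type functions. -/
theorem standardized_evaluation_lipschitz (T : ℝ) (hT : 0 < T)
    (P : Measure C(ℝ, ℝ)) [IsProbabilityMeasure P]
    (hP : P {f | IsLandscapeType T f} = 1)
    (t₁ t₂ c : ℝ) (ht₁ : 0 ≤ t₁) (h₁₂ : t₁ < t₂) (ht₂ : t₂ ≤ T) (hc : 0 < c)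
    (hσ : ∀ t ∈ Icc t₁ t₂, c ≤ lsd P t)
    (f : ℝ → ℝ) (hf : IsLandscapeType T f)
    (t u : ℝ) (ht : t ∈ Icc t₁ t₂) (hu : u ∈ Icc t₁ t₂) :
    |f t / lsd P t - f u / lsd P u| ≤ |t - u| * (T ^ 2 + 2 * c ^ 2) / (2 * c ^ 3) := by
  have h := ae_isLandscapeType hP
  calc |f t / lsd P t - f u / lsd P u|
      ≤ |f t - f u| / c + |f u| * |lsd P t - lsd P u| / c ^ 2 :=
        abs_div_sub_div_le hc (hσ t ht) (hσ u hu)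
    _ ≤ |t - u| / c + T / 2 * (T * |t - u| / c) / c ^ 2 := by
        have hfu : |f u| ≤ T / 2 := (abs_of_nonneg (hf.2.1 u).1).trans_le (hf.2.1 u).2
        have hftu := hf.abs_sub_le t u
        have hsd := abs_lsd_sub_le h hc (hσ t ht) (hσ u hu)
        gcongr ?_ / c + ?_ * ?_ / c ^ 2
    _ = |t - u| * (T ^ 2 + 2 * c ^ 2) / (2 * c ^ 3) := by
        field_simp
        ring
end
end
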